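/- Let s be a weak composition and T an s-decreasing tree with tree ascents (a,b) and (c,d), a < c, and let Z and Q be the s-tree rotations of T along (a,b) and (c,d). If (c,d) is not a tree ascent of Z, then there is a saturated chain T ⋖ Z ⋖ P ⋖ Z ∨ Q in s-weak order in which P is the s-tree rotation of Z along the tree ascent (a,d) of Z, and Z ∨ Q is the s-tree rotation of P along the tree ascent (c,d) of P. -/

import Mathlib

open scoped Classical

/-- An `s`-decreasing tree with internal vertices `1,…,n` (the root is `n`), encoded by
recording, for each non-root internal vertex `v`, its parent `parent v` (an internal vertex
with a larger label, so that labels decrease away from the root) and the index `idx v` of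
the child slot of `parent v` (among `0,…,s (parent v)`, left to right) containing `v`.
Distinct internal vertices occupy distinct child slots; all remaining slots are leaves. -/
structure SDecTree (n : ℕ) (s : ℕ → ℕ) where
  parent : ℕ → ℕ
  idx : ℕ → ℕ
  parent_gt : ∀ v, 1 ≤ v → v < n → v < parent v
  parent_le : ∀ v, 1 ≤ v → v < n → parent v ≤ n
  idx_le : ∀ v, 1 ≤ v → v < n → idx v ≤ s (parent v)
  slot_inj : ∀ v w, 1 ≤ v → v < n → 1 ≤ w → w < n →
      parent v = parent w → idx v = idx w → v = w
  parent_out : ∀ v, v = 0 ∨ n ≤ v → parent v = 0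
  idx_out : ∀ v, v = 0 ∨ n ≤ v → idx v = 0

namespace SDecTree

variable {n : ℕ} {s : ℕ → ℕ}

/-- `y` is a weak ancestor of `x`, i.e. `x` is a labeled vertex of the subtree `T^y`. -/
def Descend (T : SDecTree n s) (x y : ℕ) : Prop :=
  ∃ k, T.parent^[k] x = y ∧ ∀ m ≤ k, 1 ≤ T.parent^[m] x ∧ T.parent^[m] x ≤ n

/-- `x` is a labeled vertex of the subtree `T^y_j` rooted at the `j`-th child of `y`. -/
def InSub (T : SDecTree n s) (y j x : ℕ) : Prop :=
  ∃ c, T.Descend x c ∧ T.parent c = y ∧ T.idx c = j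

/-- `x` lies strictly left of `y` in the planar tree `T`. -/
def LeftOf (T : SDecTree n s) (x y : ℕ) : Prop :=
  ∃ z j₁ j₂, j₁ < j₂ ∧ T.InSub z j₁ x ∧ T.InSub z j₂ y

/-- The cardinality `#_T(y,x)` of the pair `(y,x)`: it is `j` if `x ∈ T^y_j`
(so `0` if `x ∈ T^y_0` and `s y` if `x ∈ T^y_{s y}`), `0` if `x` is left of `y`, and
`s y` if `x` is right of `y`; it is `0` for out-of-range pairs. -/
noncomputable def card (T : SDecTree n s) (y x : ℕ) : ℕ :=
  if h : ∃ j, T.InSub y j x then h.choose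
  else if 1 ≤ x ∧ x < y ∧ y ≤ n ∧ ¬ T.LeftOf x y then s y else 0

/-- `x` is a labeled vertex of `T^a ∖ 0`, i.e. of `T^a` with `T^a_0` replaced by a leaf. -/
def InSubMinus0 (T : SDecTree n s) (a x : ℕ) : Prop :=
  x = a ∨ ∃ j, 0 < j ∧ T.InSub a j x

/-- `(a,b)` is a tree ascent of `T`. -/
def TreeAscent (T : SDecTree n s) (a b : ℕ) : Prop :=
  1 ≤ a ∧ a < b ∧ b ≤ n ∧
  (∃ i, i < s b ∧ T.InSub b i a) ∧
  (∀ e j, a < e → e < b → T.InSub e j a → j = s e) ∧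
  (0 < s a → ∀ x, ¬ T.InSub a (s a) x)

end SDecTree

/-- A multi-inversion set (encoded by its multiplicity function) is transitive:
if `a < b < c` then `#(b,a) = 0` or `#(c,a) ≥ #(c,b)`. -/
def IsTransitiveInv (I : ℕ → ℕ → ℕ) : Prop :=
  ∀ a b c, a < b → b < c → I b a = 0 ∨ I c b ≤ I c a

/-- The transitive closure of a multi-inversion set: the smallest (by inclusion, i.e.
pointwise on multiplicities) transitive multi-inversion set containing it. -/
noncomputable def tcInv (I : ℕ → ℕ → ℕ) : ℕ → ℕ → ℕ := fun y x =>
  sInf {m | ∃ J : ℕ → ℕ → ℕ, IsTransitiveInv J ∧ (∀ y' x', I y' x' ≤ J y' x') ∧ J y x = m}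

/-- Add one copy of the inversion `(b,a)` to `I`, capping the multiplicity at `s b`. -/
def addInv (s : ℕ → ℕ) (I : ℕ → ℕ → ℕ) (b a : ℕ) : ℕ → ℕ → ℕ := fun y x =>
  if y = b ∧ x = a then min (I y x + 1) (s y) else I y x

namespace SDecTree

variable {n : ℕ} {s : ℕ → ℕ}

/-- The `s`-weak order: `T ⪯ Z` iff `#_T(y,x) ≤ #_Z(y,x)` for all pairs. -/
def wle (T Z : SDecTree n s) : Prop := ∀ y x, T.card y x ≤ Z.card y x

/-- Strict `s`-weak order. -/
def wlt (T Z : SDecTree n s) : Prop := wle T Z ∧ ¬ wle Z T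

/-- Cover relation in the `s`-weak order. -/
def wcov (T Z : SDecTree n s) : Prop := wlt T Z ∧ ∀ U, wlt T U → wlt U Z → False

/-- `W` is the join of `T` and `Z` in the `s`-weak order. -/
def IsJoin (T Z W : SDecTree n s) : Prop :=
  wle T W ∧ wle Z W ∧ ∀ U, wle T U → wle Z U → wle W U

/-- `Z` is the `s`-tree rotation of `T` along the tree ascent `(a,b)`, i.e.
`inv Z = (inv T + (b,a))^tc`. -/
def IsRotation (T Z : SDecTree n s) (a b : ℕ) : Prop :=
  T.TreeAscent a b ∧
  ∀ y x, 1 ≤ x → x < y → y ≤ n → Z.card y x = tcInv (addInv s T.card b a) y x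

/-- The set `A_T(a,b)` of inversions added by a rotation producing `Z`: the pairs `(f,e)`
with `#_Z(f,e) > #_T(f,e)`. -/
def Aset (T Z : SDecTree n s) : Set (ℕ × ℕ) :=
  {p | T.card p.1 p.2 < Z.card p.1 p.2}

/-- The set `A_T(a,b)` described directly via the transitive closure. -/
def ARot (T : SDecTree n s) (a b : ℕ) : Set (ℕ × ℕ) :=
  {p | T.card p.1 p.2 < tcInv (addInv s T.card b a) p.1 p.2}

/-- The set `F_T(a,c)` (here `b` and `d` are the partners of `a` and `c` in the
respective tree ascents `(a,b)` and `(c,d)`): it is `{(d,e) : e ∈ T^a∖0}` if `b = c`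
and `a ∈ T^c_0`, and empty otherwise. -/
def Fset (T : SDecTree n s) (a b c d : ℕ) : Set (ℕ × ℕ) :=
  {p | b = c ∧ T.InSub c 0 a ∧ p.1 = d ∧ T.InSubMinus0 a p.2}

/-- `T` is an `s`-Tamari tree: `#_T(c,a) ≤ #_T(c,b)` whenever `a < b < c`. -/
def IsTamari (T : SDecTree n s) : Prop :=
  ∀ a b c, a < b → b < c → T.card c a ≤ T.card c b

/-- `(a,b)` is a Tamari tree ascent of `T`: `a` is a non-rightmost child of `b`. -/
def TamariAscent (T : SDecTree n s) (a b : ℕ) : Prop :=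
  1 ≤ a ∧ a < n ∧ T.parent a = b ∧ T.card b a < s b

/-- `Z` is the `s`-Tamari rotation of `T` along the Tamari tree ascent `(a,b)`. -/
def IsTamRotation (T Z : SDecTree n s) (a b : ℕ) : Prop :=
  T.TamariAscent a b ∧
  ∀ y x, 1 ≤ x → x < y → y ≤ n → Z.card y x = tcInv (addInv s T.card b a) y x

/-- Cover relation in the `s`-Tamari lattice. -/
def tamcov (T Z : SDecTree n s) : Prop :=
  IsTamari T ∧ IsTamari Z ∧ wlt T Z ∧ ∀ U, IsTamari U → wlt T U → wlt U Z → False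

/-- `W` is the join of `T` and `Z` in the `s`-Tamari lattice. -/
def IsTamJoin (T Z W : SDecTree n s) : Prop :=
  IsTamari W ∧ wle T W ∧ wle Z W ∧ ∀ U, IsTamari U → wle T U → wle Z U → wle W U

/-- The open interval `(T,Z)` in the `s`-weak order. -/
def OpenInterval (T Z : SDecTree n s) : Set (SDecTree n s) := {U | wlt T U ∧ wlt U Z}

/-- A set of trees forming a chain in the `s`-weak order. -/
def IsChainSet (C : Set (SDecTree n s)) : Prop :=
  C.Pairwise fun U V => wlt U V ∨ wlt V U

/-- The geometric realization of the order complex `Δ(T,Z)` of the open interval `(T,Z)`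
in the `s`-weak order: the space of finitely supported probability vectors on the vertex
set whose support is a chain of the open interval. -/
def orderComplex (T Z : SDecTree n s) : Set (SDecTree n s → ℝ) :=
  {f | (∀ U, 0 ≤ f U) ∧ (Function.support f).Finite ∧
    Function.support f ⊆ OpenInterval T Z ∧ IsChainSet (Function.support f) ∧
    ∑ᶠ U, f U = 1}

/-- The geometric realization of the order complex of the open interval `(T,Z)` in the
`s`-Tamari lattice. -/
def tamOrderComplex (T Z : SDecTree n s) : Set (SDecTree n s → ℝ) :=
  {f | (∀ U, 0 ≤ f U) ∧ (Function.support f).Finite ∧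
    Function.support f ⊆ {U | IsTamari U ∧ wlt T U ∧ wlt U Z} ∧
    IsChainSet (Function.support f) ∧ ∑ᶠ U, f U = 1}

end SDecTree

/-- The list of labels of the consecutive cover relations along a saturated chain,
recorded as a list of poset elements. -/
def labelsOf {α : Type*} (lab : α → α → ℕ) (L : List α) : List ℕ :=
  (L.zip L.tail).map fun p => lab p.1 p.2

/-! ### Abstract inversion sets -/

/-- The multi-inversion sets of `s`-decreasing trees. -/
structure TInv (n : ℕ) (s : ℕ → ℕ) (I : ℕ → ℕ → ℕ) : Prop where
  supp : ∀ y x, I y x ≠ 0 → 1 ≤ x ∧ x < y ∧ y ≤ n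
  bd : ∀ y x, I y x ≤ s y
  tr : ∀ x y z, x < y → y < z → I y x ≠ 0 → I z y ≤ I z x
  pl : ∀ x y z, x < y → y < z → I y x ≠ s y → I z x ≤ I z y

/-- ancestor relation read off from an inversion set -/
def anc (I : ℕ → ℕ → ℕ) (x y : ℕ) : Prop := ∀ z, y < z → I z x = I z y

/-- tree ascents read off from an inversion set -/
structure Asc (n : ℕ) (s : ℕ → ℕ) (I : ℕ → ℕ → ℕ) (a b : ℕ) : Prop where
  one_le : 1 ≤ a
  lt : a < b
  le : b ≤ n
  an : anc I a b
  lts : I b a < s b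
  mid : ∀ e, a < e → e < b → anc I a e → I e a = s e
  leaf : 0 < s a → ∀ x, 1 ≤ x → x < a → anc I x a → I a x ≠ s a

/-- the vertices moved by a rotation -/
def Mov (I : ℕ → ℕ → ℕ) (a x : ℕ) : Prop := x = a ∨ (x < a ∧ anc I x a ∧ 0 < I a x)

/-- explicit rotation -/
noncomputable def rot (I : ℕ → ℕ → ℕ) (a b : ℕ) : ℕ → ℕ → ℕ := fun y x =>
  if y = b ∧ Mov I a x then I y x + 1 else I y x

theorem Mov.le {I : ℕ → ℕ → ℕ} {a x : ℕ} (h : Mov I a x) : x ≤ a := by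
  rcases h with h | h <;> omega

theorem Mov.eq {I : ℕ → ℕ → ℕ} {a x : ℕ} (h : Mov I a x) {z : ℕ} (hz : a < z) :
    I z x = I z a := by
  rcases h with h | h
  · rw [h]
  · exact h.2.1 z hz

theorem rot_of_ne {I : ℕ → ℕ → ℕ} {a b y x : ℕ} (h : y ≠ b) : rot I a b y x = I y x := by
  simp [rot, h]

theorem rot_of_not {I : ℕ → ℕ → ℕ} {a b y x : ℕ} (h : ¬ Mov I a x) : rot I a b y x = I y x := by
  simp [rot, h]

theorem rot_of_lt {I : ℕ → ℕ → ℕ} {a b y x : ℕ} (h : a < x) : rot I a b y x = I y x :=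
  rot_of_not (fun h' => by have := h'.le; omega)

theorem rot_of_mov {I : ℕ → ℕ → ℕ} {a b x : ℕ} (h : Mov I a x) :
    rot I a b b x = I b x + 1 := by
  simp [rot, h]

theorem le_rot {I : ℕ → ℕ → ℕ} (a b y x : ℕ) : I y x ≤ rot I a b y x := by
  unfold rot; split_ifs <;> omega

/-- The maximal row in which two columns differ is a common ancestor. -/
theorem TInv.max_anc {n : ℕ} {s : ℕ → ℕ} {I : ℕ → ℕ → ℕ} (h : TInv n s I) {x y w : ℕ}
    (hx : x < w) (hy : y < w) (hne : I w x ≠ I w y) (hz : ∀ z, w < z → I z x = I z y) :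
    anc I x w ∧ anc I y w := by
  have key : anc I x w := by
    intro z' hz'
    by_contra hc
    have e := hz z' hz'
    rcases lt_or_gt_of_ne hc with hc | hc
    · have h1 : I w x = 0 := by
        by_contra h0
        have := h.tr x w z' hx hz' h0
        omega
      have h2 : I w y = 0 := by
        by_contra h0
        have := h.tr y w z' hy hz' h0
        omega
      omega
    · have h1 : I w x = s w := by
        by_contra h0
        have := h.pl x w z' hx hz' h0
        omega
      have h2 : I w y = s w := by
        by_contra h0
        have := h.pl y w z' hy hz' h0
        omega
      omega
  exact ⟨key, fun z hz' => by rw [← hz z hz']; exact key z hz'⟩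

/-- existence of a maximal row below a bound -/
theorem exists_max_row {P : ℕ → Prop} {w N : ℕ} (hw : P w) (hN : ∀ z, N ≤ z → ¬ P z) :
    ∃ m, w ≤ m ∧ m < N ∧ P m ∧ ∀ z, m < z → ¬ P z := by
  have hwN : w < N := by
    by_contra h
    exact hN w (by omega) hw
  have h1 := Nat.findGreatest_spec (P := P) (n := N) hwN.le hw
  have h2 := Nat.le_findGreatest (P := P) (n := N) hwN.le hw
  refine ⟨Nat.findGreatest P N, h2, ?_, h1, ?_⟩
  · by_contra h
    exact hN _ (by omega) h1
  · intro z hz hPz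
    by_cases hzN : z ≤ N
    · have := Nat.le_findGreatest (P := P) (n := N) hzN hPz
      omega
    · exact hN z (by omega) hPz

/-- Two columns to the right of ascent data: if `x` and `a` agree in rows `≥ b` then in all
rows strictly between where `x` is larger ... none. -/
theorem TInv.agree {n : ℕ} {s : ℕ → ℕ} {I : ℕ → ℕ → ℕ} (h : TInv n s I) {a b x : ℕ}
    (ha : Asc n s I a b) (hx : ∀ z, b ≤ z → I z a = I z x) (y : ℕ) (hya : a ≤ y) (hyx : x ≤ y)
    (hle : ∀ z, y < z → I z a ≤ I z x) : ∀ z, y < z → I z a = I z x := by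
  intro w hw
  by_contra hne
  obtain ⟨m, h1, h2, h3, h4⟩ := exists_max_row (P := fun z => I z a ≠ I z x) (w := w) (N := b) hne
    (fun z hz hc => hc (hx z hz))
  have := h.max_anc (x := a) (y := x) (w := m) (by omega) (by omega) h3
    (fun z hz => by by_contra hc; exact h4 z hz hc)
  have h5 := ha.mid m (by omega) h2 this.1
  have h6 := h.bd m x
  have h7 := hle m (by omega)
  omega

/-- vertices right of `a` are in a later slot of `b` -/
theorem TInv.right {n : ℕ} {s : ℕ → ℕ} {I : ℕ → ℕ → ℕ} (h : TInv n s I) {a b x : ℕ}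
    (ha : Asc n s I a b) (hx : x < a) (h0 : 0 < I a x) (hn : ¬ anc I x a) : I b a < I b x := by
  have hle : ∀ z, a < z → I z a ≤ I z x := fun z hz => h.tr x a z hx hz (by omega)
  by_contra hc
  have hb : I b a = I b x := by have := hle b ha.lt; omega
  have hx' : ∀ z, b ≤ z → I z a = I z x := by
    intro z hz
    rcases hz.eq_or_lt with rfl | hz
    · exact hb
    · by_contra hne
      have h1 := hle z (by have := ha.lt; omega)
      have h2 := ha.an z hz
      have h3 : I b x = s b := by
        by_contra h0
        have := h.pl x b z (by have := ha.lt; omega) hz h0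
        omega
      have := ha.lts
      omega
  exact hn (fun z hz => (h.agree ha hx' a le_rfl hx.le hle z hz).symm)

theorem TInv.rot {n : ℕ} {s : ℕ → ℕ} {I : ℕ → ℕ → ℕ} (h : TInv n s I) {a b : ℕ}
    (ha : Asc n s I a b) : TInv n s (rot I a b) := by
  have hab := ha.lt
  refine ⟨?_, ?_, ?_, ?_⟩
  · intro y x hyx
    by_cases hm : y = b ∧ Mov I a x
    · obtain ⟨rfl, hm⟩ := hm
      have h1 := ha.one_le
      have h2 := ha.le
      rcases hm with rfl | hm
      · omega
      · have := h.supp a x (by omega)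
        omega
    · apply h.supp
      simpa [_root_.rot, hm] using hyx
  · intro y x
    by_cases hm : y = b ∧ Mov I a x
    · obtain ⟨rfl, hm⟩ := hm
      rw [rot_of_mov hm, hm.eq hab]
      exact ha.lts
    · have := h.bd y x
      simpa [_root_.rot, hm] using this
  · intro x y z hxy hyz h0
    by_cases hy : y = b
    · subst hy
      rw [rot_of_ne (by omega), rot_of_ne (by omega)]
      by_cases hm : Mov I a x
      · rw [hm.eq (by omega), ha.an z hyz]
      · rw [rot_of_not hm] at h0
        exact h.tr x y z hxy hyz h0
    · rw [rot_of_ne hy] at h0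
      have h1 := h.tr x y z hxy hyz h0
      by_cases hz : z = b
      · subst hz
        by_cases hm : Mov I a y
        · by_cases hm' : Mov I a x
          · rw [rot_of_mov hm, rot_of_mov hm']; omega
          · rw [rot_of_mov hm, rot_of_not hm', hm.eq hab]
            have hxa : x < a := by have := hm.le; omega
            have hax : 0 < I a x := by
              rcases hm with rfl | hm
              · omega
              · have := h.tr x y a hxy hm.1 h0
                omega
            exact h.right ha hxa hax (fun hc => hm' (Or.inr ⟨hxa, hc, hax⟩))
        · rw [rot_of_not hm]
          exact h1.trans (le_rot _ _ _ _)
      · rw [rot_of_ne hz, rot_of_ne hz]; exact h1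
  · intro x y z hxy hyz h0
    by_cases hy : y = b
    · subst hy
      rw [rot_of_ne (by omega), rot_of_ne (by omega)]
      by_cases hm : Mov I a x
      · rw [hm.eq (by omega), ha.an z hyz]
      · rw [rot_of_not hm] at h0
        exact h.pl x y z hxy hyz h0
    · rw [rot_of_ne hy] at h0
      have h1 := h.pl x y z hxy hyz h0
      by_cases hz : z = b
      · subst hz
        by_cases hm : Mov I a x
        · by_cases hm' : Mov I a y
          · rw [rot_of_mov hm, rot_of_mov hm']; omega
          · rw [rot_of_mov hm, rot_of_not hm', hm.eq hab]
            rcases lt_trichotomy y a with hya | hya | hya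
            · have hay : 0 < I a y := by
                rcases hm with rfl | hm
                · omega
                · have := h.pl x y a hxy hya h0
                  omega
              exact h.right ha hya hay (fun hc => hm' (Or.inr ⟨hya, hc, hay⟩))
            · exact absurd (Or.inl hya) hm'
            · rw [hm.eq hya] at h0
              have hle : ∀ w, y < w → I w a ≤ I w y := fun w hw => h.pl a y w hya hw h0
              by_contra hc
              have hb : I z a = I z y := by have := hle z hyz; omega
              have hx' : ∀ w, z ≤ w → I w a = I w y := by
                intro w hw
                rcases hw.eq_or_lt with rfl | hw
                · exact hb
                · by_contra hne
                  have h1 := hle w (by omega)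
                  have h2 := ha.an w hw
                  have h3 : I z y = s z := by
                    by_contra h0
                    have := h.pl y z w (by omega) hw h0
                    omega
                  have := ha.lts
                  omega
              have := h.agree ha hx' y hya.le le_rfl hle
              exact h0 (ha.mid y hya hyz this)
        · rw [rot_of_not hm]
          exact h1.trans (le_rot _ _ _ _)
      · rw [rot_of_ne hz, rot_of_ne hz]; exact h1

theorem rot_le {n : ℕ} {s : ℕ → ℕ} {I J : ℕ → ℕ → ℕ} {a b : ℕ} (ha : Asc n s I a b)
    (hJ : ∀ x y z, x < y → y < z → J y x ≠ 0 → J z y ≤ J z x)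
    (hIJ : ∀ y x, I y x ≤ J y x) (hb : I b a < J b a) (y x : ℕ) : rot I a b y x ≤ J y x := by
  by_cases hm : y = b ∧ Mov I a x
  · obtain ⟨rfl, hm⟩ := hm
    rw [rot_of_mov hm, hm.eq ha.lt]
    rcases hm with rfl | hm
    · exact hb
    · have := hJ x a y hm.1 ha.lt (by have := hIJ a x; omega)
      omega
  · have := hIJ y x
    simpa [rot, hm] using this

theorem tcInv_eq_rot {n : ℕ} {s : ℕ → ℕ} {I : ℕ → ℕ → ℕ} (h : TInv n s I) {a b : ℕ}
    (ha : Asc n s I a b) (y x : ℕ) : tcInv (addInv s I b a) y x = rot I a b y x := by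
  have hadd : ∀ y x, addInv s I b a y x ≤ rot I a b y x := by
    intro y x
    unfold addInv
    split_ifs with hc
    · obtain ⟨rfl, rfl⟩ := hc
      rw [rot_of_mov (Or.inl rfl)]
      exact min_le_left _ _
    · exact le_rot _ _ _ _
  apply le_antisymm
  · apply Nat.sInf_le
    refine ⟨rot I a b, ?_, hadd, rfl⟩
    intro p q r hpq hqr
    by_cases h0 : rot I a b q p = 0
    · exact Or.inl h0
    · exact Or.inr ((h.rot ha).tr p q r hpq hqr h0)
  · apply le_csInf
    · refine ⟨_, rot I a b, ?_, hadd, rfl⟩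
      intro p q r hpq hqr
      by_cases h0 : rot I a b q p = 0
      · exact Or.inl h0
      · exact Or.inr ((h.rot ha).tr p q r hpq hqr h0)
    · rintro m ⟨J, hJ, hIJ, rfl⟩
      apply rot_le ha
      · intro p q r hpq hqr h0
        exact (hJ p q r hpq hqr).resolve_left h0
      · intro y x
        refine le_trans ?_ (hIJ y x)
        unfold addInv
        split_ifs with hc
        · have := h.bd y x
          omega
        · exact le_rfl
      · have h1 := hIJ b a
        have := ha.lts
        simp only [addInv, and_self, if_true] at h1
        omega

/-- nothing lies strictly between an inversion set and its rotation -/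
theorem rot_cover {n : ℕ} {s : ℕ → ℕ} {I U : ℕ → ℕ → ℕ} (h : TInv n s I) (hU : TInv n s U)
    {a b : ℕ} (ha : Asc n s I a b) (h1 : ∀ y x, I y x ≤ U y x)
    (h2 : ∀ y x, U y x ≤ rot I a b y x) (hne : ¬ ∀ y x, U y x ≤ I y x) (y x : ℕ) :
    rot I a b y x ≤ U y x := by
  push Not at hne
  obtain ⟨p, q, hpq⟩ := hne
  have h3 := h2 p q
  by_cases hm : p = b ∧ Mov I a q
  · obtain ⟨rfl, hm⟩ := hm
    apply rot_le ha hU.tr h1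
    have he := hm.eq ha.lt
    rcases hm with rfl | hm
    · exact hpq
    · have h4 := h2 a q
      rw [rot_of_ne (by have := ha.lt; omega)] at h4
      have h5 := h1 a q
      have h6 := h.supp a q (by omega)
      have h7 := ha.leaf (by have := h.bd a q; omega) q h6.1 hm.1 hm.2.1
      have h8 := hU.pl q a p hm.1 ha.lt (by omega)
      omega
  · have : rot I a b p q = I p q := by simp [rot, hm]
    omega

/-- Case analysis when `(c,d)` stops being an ascent. -/
theorem asc_case {n : ℕ} {s : ℕ → ℕ} {I : ℕ → ℕ → ℕ} (h : TInv n s I) {a b c d : ℕ}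
    (hac : a < c) (h1 : Asc n s I a b) (h2 : Asc n s I c d)
    (hn : ¬ Asc n s (rot I a b) c d) : b = c ∧ I c a + 1 = s c := by
  by_contra hcon
  apply hn
  have hcd := h2.lt
  refine ⟨h2.one_le, h2.lt, h2.le, ?_, ?_, ?_, ?_⟩
  · intro z hz
    rw [rot_of_lt hac, rot_of_lt (by omega)]
    exact h2.an z hz
  · rw [rot_of_lt hac]; exact h2.lts
  · intro e hce hed han
    rw [rot_of_lt hac]
    apply h2.mid e hce hed
    intro z hz
    have := han z hz
    rwa [rot_of_lt hac, rot_of_lt (by omega)] at this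
  · intro hs x hx1 hxc han hxs
    by_cases hm : Mov I a x
    · by_cases hbc : b = c
      · subst hbc
        rw [rot_of_mov hm, hm.eq hac] at hxs
        exact hcon ⟨rfl, hxs⟩
      · rw [rot_of_ne (Ne.symm hbc)] at hxs
        rcases lt_or_gt_of_ne hbc with hlt | hgt
        · refine h2.leaf hs x hx1 hxc ?_ hxs
          intro z hz
          have := han z hz
          rwa [rot_of_ne (by omega), rot_of_ne (by omega)] at this
        · have h3 := han b hgt
          rw [rot_of_mov hm, rot_of_lt hac, hm.eq h1.lt] at h3
          rw [hm.eq hac] at hxs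
          have := h.tr a c b hac hgt (by omega)
          omega
    · rw [rot_of_not hm] at hxs
      refine h2.leaf hs x hx1 hxc ?_ hxs
      intro z hz
      have := han z hz
      rwa [rot_of_not hm, rot_of_lt hac] at this

theorem asc_Z {n : ℕ} {s : ℕ → ℕ} {I : ℕ → ℕ → ℕ} {a c d : ℕ}
    (h1 : Asc n s I a c) (h2 : Asc n s I c d) (hs : I c a + 1 = s c) :
    Asc n s (rot I a c) a d := by
  have hac := h1.lt
  have hcd := h2.lt
  have hma : Mov I a a := Or.inl rfl
  refine ⟨h1.one_le, by omega, h2.le, ?_, ?_, ?_, ?_⟩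
  · intro z hz
    rw [rot_of_ne (by omega), rot_of_ne (by omega), h1.an z (by omega), h2.an z hz]
  · rw [rot_of_ne (by omega), h1.an d hcd]; exact h2.lts
  · intro e hae hed han
    rcases lt_trichotomy e c with hec | rfl | hec
    · exfalso
      have h3 := han c hec
      rw [rot_of_mov hma, rot_of_lt hae] at h3
      refine h2.leaf (by omega) e (by have := h1.one_le; omega) hec ?_ (by omega)
      intro z hz
      have h4 := han z (by omega)
      rw [rot_of_ne (by omega), rot_of_ne (by omega)] at h4
      rw [← h4, h1.an z hz]
    · rw [rot_of_mov hma]; exact hs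
    · rw [rot_of_ne (by omega), h1.an e hec]
      apply h2.mid e hec hed
      intro z hz
      have h4 := han z hz
      rw [rot_of_ne (by omega), rot_of_ne (by omega)] at h4
      rw [← h4, h1.an z (by omega)]
  · intro hsa x hx1 hxa han hxs
    rw [rot_of_ne (by omega)] at hxs
    by_cases hm : Mov I a x
    · rcases hm with rfl | hm
      · omega
      · exact h1.leaf hsa x hx1 hxa hm.2.1 hxs
    · have h3 := han c hac
      rw [rot_of_not hm, rot_of_mov hma] at h3
      refine h2.leaf (by omega) x hx1 (by omega) ?_ (by omega)
      intro z hz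
      have h4 := han z (by omega)
      rw [rot_of_ne (by omega), rot_of_ne (by omega)] at h4
      rw [h4, h1.an z hz]

theorem asc_P {n : ℕ} {s : ℕ → ℕ} {I : ℕ → ℕ → ℕ} {a c d : ℕ}
    (h1 : Asc n s I a c) (h2 : Asc n s I c d) :
    Asc n s (rot (rot I a c) a d) c d := by
  have hac := h1.lt
  have hcd := h2.lt
  refine ⟨h2.one_le, hcd, h2.le, ?_, ?_, ?_, ?_⟩
  · intro z hz
    rw [rot_of_lt hac, rot_of_lt hac, rot_of_lt (by omega), rot_of_lt (by omega)]
    exact h2.an z hz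
  · rw [rot_of_lt hac, rot_of_lt hac]; exact h2.lts
  · intro e hce hed han
    rw [rot_of_lt hac, rot_of_lt hac]
    apply h2.mid e hce hed
    intro z hz
    have h4 := han z hz
    rwa [rot_of_lt hac, rot_of_lt hac, rot_of_lt (by omega), rot_of_lt (by omega)] at h4
  · intro hsc x hx1 hxc han hxs
    rw [rot_of_ne (by omega)] at hxs
    by_cases hm2 : Mov (rot I a c) a x
    · have h3 := han d hcd
      rw [rot_of_mov hm2, hm2.eq (by omega), rot_of_ne (by omega), rot_of_lt hac, rot_of_lt hac,
        h1.an d hcd] at h3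
      omega
    · by_cases hm : Mov I a x
      · apply hm2
        rcases hm with rfl | hm
        · exact Or.inl rfl
        · refine Or.inr ⟨hm.1, ?_, ?_⟩
          · intro z hz
            by_cases hzc : z = c
            · subst hzc
              rw [rot_of_mov (Or.inr hm), rot_of_mov (Or.inl rfl), hm.2.1 z hz]
            · rw [rot_of_ne hzc, rot_of_ne hzc, hm.2.1 z hz]
          · rw [rot_of_ne (by omega)]; exact hm.2.2
      · rw [rot_of_not hm] at hxs
        refine h2.leaf hsc x hx1 hxc ?_ hxs
        intro z hz
        have h3 := han z hz
        rwa [rot_of_not hm2, rot_of_not hm, rot_of_lt hac, rot_of_lt hac] at h3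

namespace SDecTree

variable {n : ℕ} {s : ℕ → ℕ}

/-! ### Facts about trees -/

theorem descend_iff (T : SDecTree n s) (x y : ℕ) :
    T.Descend x y ↔ (1 ≤ x ∧ x ≤ n) ∧ (x = y ∨ T.Descend (T.parent x) y) := by
  constructor
  · rintro ⟨k, hk, hm⟩
    refine ⟨hm 0 (Nat.zero_le _), ?_⟩
    cases k with
    | zero => exact Or.inl hk
    | succ k =>
      refine Or.inr ⟨k, by simpa [Function.iterate_succ_apply] using hk, fun m hmk => ?_⟩
      have := hm (m + 1) (by omega)
      simpa [Function.iterate_succ_apply] using this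
  · rintro ⟨hx, rfl | ⟨k, hk, hm⟩⟩
    · refine ⟨0, rfl, fun m hm => ?_⟩
      obtain rfl : m = 0 := by omega
      exact hx
    · refine ⟨k + 1, by simpa [Function.iterate_succ_apply] using hk, fun m hmk => ?_⟩
      cases m with
      | zero => exact hx
      | succ m =>
        have := hm m (by omega)
        simpa [Function.iterate_succ_apply] using this

theorem not_descend_zero (T : SDecTree n s) (y : ℕ) : ¬ T.Descend 0 y := by
  intro h
  have := ((T.descend_iff 0 y).1 h).1
  omega

theorem Descend.range {T : SDecTree n s} {x y : ℕ} (h : T.Descend x y) : 1 ≤ x ∧ x ≤ n :=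
  ((T.descend_iff x y).1 h).1

theorem descend_refl (T : SDecTree n s) {x : ℕ} (h1 : 1 ≤ x) (h2 : x ≤ n) : T.Descend x x :=
  (T.descend_iff x x).2 ⟨⟨h1, h2⟩, Or.inl rfl⟩

/-- If the parent is positive then the vertex is not the root. -/
theorem lt_of_parent (T : SDecTree n s) {x : ℕ} (h : 1 ≤ T.parent x) : 1 ≤ x ∧ x < n := by
  by_contra hc
  have := T.parent_out x (by omega)
  omega

/-- induction up the tree -/
theorem up_induction (T : SDecTree n s) {P : ℕ → Prop}
    (h : ∀ x, (1 ≤ x ∧ x < n → P (T.parent x)) → P x) (x : ℕ) : P x := by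
  have key : ∀ k x, n - x ≤ k → P x := by
    intro k
    induction k with
    | zero =>
      intro x hx
      exact h x (fun hh => by omega)
    | succ k ih =>
      intro x hx
      refine h x (fun hh => ih _ ?_)
      have := T.parent_gt x hh.1 hh.2
      omega
  exact key (n - x) x le_rfl

theorem Descend.le {T : SDecTree n s} {x y : ℕ} : T.Descend x y → x ≤ y ∧ y ≤ n := by
  induction x using T.up_induction with
  | h x ih =>
    intro h
    obtain ⟨hx, rfl | h'⟩ := (T.descend_iff x y).1 h
    · omega
    · have hr := T.lt_of_parent h'.range.1
      have := ih hr h'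
      have := T.parent_gt x hr.1 hr.2
      omega

theorem Descend.trans {T : SDecTree n s} {x y z : ℕ} (h : T.Descend x y) (h2 : T.Descend y z) :
    T.Descend x z := by
  induction x using T.up_induction with
  | h x ih =>
    obtain ⟨hx, rfl | h'⟩ := (T.descend_iff x y).1 h
    · exact h2
    · exact (T.descend_iff x z).2 ⟨hx, Or.inr (ih (T.lt_of_parent h'.range.1) h')⟩

theorem Descend.chain {T : SDecTree n s} {x y z : ℕ} (h : T.Descend x y) (h2 : T.Descend x z)
    (hyz : y ≤ z) : T.Descend y z := by
  induction x using T.up_induction with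
  | h x ih =>
    obtain ⟨hx, rfl | h'⟩ := (T.descend_iff x y).1 h
    · exact h2
    · obtain ⟨_, rfl | h2'⟩ := (T.descend_iff x z).1 h2
      · have := h.le
        obtain rfl : y = x := by omega
        exact h2
      · exact ih (T.lt_of_parent h'.range.1) h' h2'

theorem descend_root (T : SDecTree n s) {x : ℕ} (h1 : 1 ≤ x) (h2 : x ≤ n) : T.Descend x n := by
  induction x using T.up_induction with
  | h x ih =>
    refine (T.descend_iff x n).2 ⟨⟨h1, h2⟩, ?_⟩
    by_cases hx : x = n
    · exact Or.inl hx
    · have h3 := T.parent_gt x h1 (by omega)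
      have h4 := T.parent_le x h1 (by omega)
      exact Or.inr (ih ⟨h1, by omega⟩ (by omega) h4)

theorem InSub.below {T : SDecTree n s} {z j x y : ℕ} (h : T.InSub z j y) (h2 : T.Descend x y) :
    T.InSub z j x := by
  obtain ⟨c, h3, h4⟩ := h
  exact ⟨c, h2.trans h3, h4⟩

theorem InSub.desc {T : SDecTree n s} {y j x : ℕ} (h : T.InSub y j x) (hy : 1 ≤ y) :
    T.Descend x y ∧ x < y ∧ j ≤ s y := by
  obtain ⟨c, h1, rfl, rfl⟩ := h
  have hr := T.lt_of_parent hy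
  have h2 := T.parent_gt c hr.1 hr.2
  have h3 := T.parent_le c hr.1 hr.2
  have h4 := h1.le
  refine ⟨h1.trans ((T.descend_iff _ _).2 ⟨by omega, Or.inr (T.descend_refl hy h3)⟩), by omega,
    T.idx_le c hr.1 hr.2⟩

theorem InSub.uniq {T : SDecTree n s} {y i j x : ℕ} (h : T.InSub y i x) (h' : T.InSub y j x) :
    i = j := by
  have key : ∀ c c', T.Descend x c → T.Descend x c' → T.parent c = T.parent c' → c ≤ c' →
      c = c' := by
    intro c c' h1 h2 h3 h4
    obtain ⟨_, h5 | h5⟩ := (T.descend_iff _ _).1 (h1.chain h2 h4)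
    · exact h5
    · have hr := h5.range
      have hl := h5.le
      have := T.lt_of_parent (x := c') (by omega)
      have := T.parent_gt c' this.1 this.2
      omega
  obtain ⟨c, h1, h2, rfl⟩ := h
  obtain ⟨c', h1', h2', rfl⟩ := h'
  rcases le_total c c' with hc | hc
  · rw [key c c' h1 h1' (by omega) hc]
  · rw [key c' c h1' h1 (by omega) hc]

theorem Descend.inSub {T : SDecTree n s} {x y : ℕ} (h : T.Descend x y) (hne : x ≠ y) :
    ∃ c, T.Descend x c ∧ T.parent c = y ∧ 1 ≤ c ∧ c < n := by
  induction x using T.up_induction with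
  | h x ih =>
    obtain ⟨hx, h1 | h1⟩ := (T.descend_iff x y).1 h
    · exact absurd h1 hne
    · have hr := T.lt_of_parent h1.range.1
      by_cases hp : T.parent x = y
      · exact ⟨x, T.descend_refl hx.1 hx.2, hp, hr⟩
      · obtain ⟨c, hc, h2⟩ := ih hr h1 hp
        exact ⟨c, (T.descend_iff _ _).2 ⟨hx, Or.inr hc⟩, h2⟩

theorem Descend.exists_inSub {T : SDecTree n s} {x y : ℕ} (h : T.Descend x y) (hne : x ≠ y) :
    ∃ j, T.InSub y j x := by
  obtain ⟨c, h1, h2, _⟩ := h.inSub hne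
  exact ⟨_, c, h1, h2, rfl⟩

theorem InSub.pos {T : SDecTree n s} {z i j x y : ℕ} (h1 : T.InSub z i x) (h2 : T.InSub z j y)
    (hij : i < j) : 1 ≤ z := by
  by_contra hz
  obtain ⟨c, h3, h4, h5⟩ := h2
  have hc := h3.le
  have hx := h3.range
  have : ¬ c < n := by
    intro hcn
    have := T.parent_gt c (by omega) hcn
    omega
  have := T.idx_out c (by omega)
  omega

theorem LeftOf.below {T : SDecTree n s} {x y x' y' : ℕ} (h : T.LeftOf x y)
    (hx : T.Descend x' x) (hy : T.Descend y' y) : T.LeftOf x' y' := by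
  obtain ⟨z, i, j, h1, h2, h3⟩ := h
  exact ⟨z, i, j, h1, h2.below hx, h3.below hy⟩

theorem LeftOf.range {T : SDecTree n s} {x y : ℕ} (h : T.LeftOf x y) :
    (1 ≤ x ∧ x ≤ n) ∧ (1 ≤ y ∧ y ≤ n) := by
  obtain ⟨z, i, j, h1, ⟨c, h2, _⟩, ⟨c', h3, _⟩⟩ := h
  exact ⟨h2.range, h3.range⟩

theorem LeftOf.irrefl {T : SDecTree n s} {x : ℕ} (h : T.LeftOf x x) : False := by
  obtain ⟨z, i, j, h1, h2, h3⟩ := h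
  have := h2.uniq h3
  omega

theorem LeftOf.not_desc {T : SDecTree n s} {x y : ℕ} (h : T.LeftOf x y) : ¬ T.Descend x y :=
  fun hd => (h.below (T.descend_refl h.range.1.1 h.range.1.2) hd).irrefl

theorem LeftOf.not_desc' {T : SDecTree n s} {x y : ℕ} (h : T.LeftOf x y) : ¬ T.Descend y x :=
  fun hd => (h.below hd (T.descend_refl h.range.2.1 h.range.2.2)).irrefl

theorem LeftOf.trans {T : SDecTree n s} {x y w : ℕ} (h : T.LeftOf x y) (h' : T.LeftOf y w) :
    T.LeftOf x w := by
  obtain ⟨z, i, j, h1, h2, h3⟩ := h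
  obtain ⟨z', i', j', h1', h2', h3'⟩ := h'
  have hz := h2.pos h3 h1
  have hz' := h2'.pos h3' h1'
  have d1 := (h3.desc hz).1
  have d2 := (h2'.desc hz').1
  rcases lt_trichotomy z z' with hlt | rfl | hlt
  · obtain ⟨k, hk⟩ := (d1.chain d2 hlt.le).exists_inSub hlt.ne
    have := (hk.below d1).uniq h2'
    subst this
    exact ⟨z', k, j', h1', hk.below (h2.desc hz).1, h3'⟩
  · have := h3.uniq h2'
    exact ⟨z, i, j', by omega, h2, h3'⟩
  · obtain ⟨k, hk⟩ := (d2.chain d1 hlt.le).exists_inSub hlt.ne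
    have := (hk.below d2).uniq h3
    subst this
    exact ⟨z, i, k, h1, h2, hk.below (h3'.desc hz').1⟩

theorem trichotomy (T : SDecTree n s) {x y : ℕ} (hx : 1 ≤ x) (hxy : x < y) (hy : y ≤ n) :
    T.Descend x y ∨ T.LeftOf x y ∨ T.LeftOf y x := by
  have hex : ∃ z, T.Descend x z ∧ T.Descend y z :=
    ⟨n, T.descend_root hx (by omega), T.descend_root (by omega) hy⟩
  obtain ⟨hzx, hzy⟩ := Nat.find_spec hex
  have hmin := fun m (hm : m < Nat.find hex) => Nat.find_min hex hm
  generalize Nat.find hex = z at hzx hzy hmin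
  by_cases hy' : y = z
  · subst hy'; exact Or.inl hzx
  · have h1 := hzy.le
    obtain ⟨c1, d1, p1, r1⟩ := hzx.inSub (by omega)
    obtain ⟨c2, d2, p2, r2⟩ := hzy.inSub hy'
    rcases lt_trichotomy (T.idx c1) (T.idx c2) with hlt | heq | hlt
    · exact Or.inr (Or.inl ⟨z, _, _, hlt, ⟨c1, d1, p1, rfl⟩, ⟨c2, d2, p2, rfl⟩⟩)
    · exfalso
      have := T.slot_inj c1 c2 r1.1 r1.2 r2.1 r2.2 (by omega) heq
      subst this
      have hgt := T.parent_gt c1 r1.1 r1.2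
      exact hmin c1 (by omega) ⟨d1, d2⟩
    · exact Or.inr (Or.inr ⟨z, _, _, hlt, ⟨c2, d2, p2, rfl⟩, ⟨c1, d1, p1, rfl⟩⟩)

theorem InSub.card_eq {T : SDecTree n s} {y j x : ℕ} (h : T.InSub y j x) : T.card y x = j := by
  have hex : ∃ j, T.InSub y j x := ⟨j, h⟩
  unfold card
  rw [dif_pos hex]
  exact hex.choose_spec.uniq h

theorem LeftOf.card_eq {T : SDecTree n s} {y x : ℕ} (h : T.LeftOf x y) : T.card y x = 0 := by
  have hex : ¬ ∃ j, T.InSub y j x := by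
    rintro ⟨j, hj⟩
    exact h.not_desc (hj.desc h.range.2.1).1
  unfold card
  rw [dif_neg hex, if_neg (fun hc => hc.2.2.2 h)]

theorem LeftOf.card_eq' {T : SDecTree n s} {y x : ℕ} (h : T.LeftOf y x) (hxy : x < y) :
    T.card y x = s y := by
  have hr := h.range
  have hex : ¬ ∃ j, T.InSub y j x := by
    rintro ⟨j, hj⟩
    exact h.not_desc' (hj.desc hr.1.1).1
  unfold card
  rw [dif_neg hex, if_pos ⟨hr.2.1, hxy, hr.1.2, fun hc => (h.trans hc).irrefl⟩]

theorem card_supp (T : SDecTree n s) (y x : ℕ) (h : T.card y x ≠ 0) : 1 ≤ x ∧ x < y ∧ y ≤ n := by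
  by_cases hex : ∃ j, T.InSub y j x
  · obtain ⟨j, hj⟩ := hex
    have h0 := hj.card_eq
    by_cases hy : 1 ≤ y
    · have := hj.desc hy
      have := this.1.range
      have := (hj.desc hy).1.le
      have := (hj.desc hy).2.1
      omega
    · exfalso
      obtain ⟨c, h1, h2, h3⟩ := hj
      have h4 := h1.le
      have h5 := h1.range
      by_cases hcn : c < n
      · have := T.parent_gt c (by omega) hcn
        omega
      · have := T.idx_out c (by omega)
        omega
  · unfold card at h
    rw [dif_neg hex] at h
    split_ifs at h with hc
    · exact ⟨hc.1, hc.2.1, hc.2.2.1⟩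
    · exact absurd rfl h

/-- Descendants have the same columns above. -/
theorem Descend.card_eq {T : SDecTree n s} {x y : ℕ} (h : T.Descend x y) {z : ℕ} (hz : y < z) :
    T.card z x = T.card z y := by
  have hl := h.le
  have hx := h.range
  by_cases hzn : z ≤ n
  · rcases T.trichotomy (x := y) (y := z) (by omega) hz hzn with h1 | h1 | h1
    · obtain ⟨k, hk⟩ := h1.exists_inSub hz.ne
      rw [hk.card_eq, (hk.below h).card_eq]
    · rw [h1.card_eq, (h1.below h (T.descend_refl (by omega) hzn)).card_eq]
    · rw [h1.card_eq' hz, (h1.below (T.descend_refl (by omega) hzn) h).card_eq' (by omega)]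
  · have h1 : T.card z x = 0 := by
      by_contra h0
      have := T.card_supp _ _ h0
      omega
    have h2 : T.card z y = 0 := by
      by_contra h0
      have := T.card_supp _ _ h0
      omega
    omega

theorem descend_iff_anc (T : SDecTree n s) {x y : ℕ} (hx : 1 ≤ x) (hxy : x < y) (hy : y ≤ n) :
    T.Descend x y ↔ anc T.card x y := by
  constructor
  · intro h z hz
    exact h.card_eq hz
  · intro h
    have key : ∀ u v z i j, i < j → T.InSub z i u → T.InSub z j v → (u = y ∨ v = y) →
        T.card z u = T.card z v → False := by
      intro u v z i j hij h1 h2 _ h3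
      rw [h1.card_eq, h2.card_eq] at h3
      omega
    rcases T.trichotomy hx hxy hy with h1 | ⟨z, i, j, h1, h2, h3⟩ | ⟨z, i, j, h1, h2, h3⟩
    · exact h1
    · have := h3.desc (h2.pos h3 h1)
      exact (key x y z i j h1 h2 h3 (Or.inr rfl) (h z this.2.1)).elim
    · have := h2.desc (h2.pos h3 h1)
      exact (key y x z i j h1 h2 h3 (Or.inl rfl) (h z this.2.1).symm).elim

theorem inSub_iff (T : SDecTree n s) {y : ℕ} (hy : 1 ≤ y) (j x : ℕ) :
    T.InSub y j x ↔ 1 ≤ x ∧ x < y ∧ y ≤ n ∧ anc T.card x y ∧ T.card y x = j := by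
  constructor
  · intro h
    have h1 := h.desc hy
    have h2 := h1.1.range
    have h3 := h1.1.le
    exact ⟨h2.1, h1.2.1, h3.2, (T.descend_iff_anc h2.1 h1.2.1 h3.2).1 h1.1, h.card_eq⟩
  · rintro ⟨h1, h2, h3, h4, h5⟩
    obtain ⟨k, hk⟩ := ((T.descend_iff_anc h1 h2 h3).2 h4).exists_inSub h2.ne
    rw [hk.card_eq] at h5
    rwa [← h5]

theorem tinv (T : SDecTree n s) : TInv n s T.card := by
  have hbd : ∀ y x, T.card y x ≤ s y := by
    intro y x
    by_cases h0 : T.card y x = 0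
    · omega
    · obtain ⟨h1, h2, h3⟩ := T.card_supp y x h0
      rcases T.trichotomy h1 h2 h3 with h4 | h4 | h4
      · obtain ⟨k, hk⟩ := h4.exists_inSub h2.ne
        rw [hk.card_eq]
        exact (hk.desc (by omega)).2.2
      · rw [h4.card_eq]; omega
      · rw [h4.card_eq' h2]
  refine ⟨T.card_supp, hbd, ?_, ?_⟩
  · intro x y z hxy hyz h0
    by_cases h00 : T.card z y = 0
    · omega
    have r1 := T.card_supp _ _ h0
    have r2 := T.card_supp _ _ h00
    have ry := T.descend_refl r2.1 r1.2.2
    have rx := T.descend_refl (x := x) r1.1 (by omega)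
    rcases T.trichotomy r1.1 hxy r1.2.2 with h1 | h1 | h1
    · rw [h1.card_eq hyz]
    · exact absurd h1.card_eq h0
    · have hno : ¬ T.LeftOf x y := fun hc => (h1.trans hc).irrefl
      rcases T.trichotomy (x := x) (y := z) r1.1 (by omega) r2.2.2 with h2 | h2 | h2
      · rcases T.trichotomy r2.1 hyz r2.2.2 with h3 | h3 | h3
        · obtain ⟨k, hk⟩ := h2.exists_inSub (by omega)
          obtain ⟨l, hl⟩ := h3.exists_inSub (by omega)
          rw [hk.card_eq, hl.card_eq]
          by_contra hc
          exact hno ⟨z, k, l, by omega, hk, hl⟩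
        · rw [h3.card_eq]; omega
        · exact absurd (h3.below h2 ry) hno
      · rcases T.trichotomy r2.1 hyz r2.2.2 with h3 | h3 | h3
        · exact absurd (h2.below rx h3) hno
        · rw [h3.card_eq]; omega
        · exact absurd (h2.trans h3) hno
      · rw [h2.card_eq' (by omega)]; exact hbd _ _
  · intro x y z hxy hyz h0
    by_cases h00 : T.card z x = 0
    · omega
    have r2 := T.card_supp _ _ h00
    have ry := T.descend_refl (x := y) (by omega) (by omega)
    have rx := T.descend_refl (x := x) r2.1 (by omega)
    rcases T.trichotomy r2.1 hxy (by omega) with h1 | h1 | h1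
    · rw [h1.card_eq hyz]
    · have hno : ¬ T.LeftOf y x := fun hc => (h1.trans hc).irrefl
      rcases T.trichotomy (x := y) (y := z) (by omega) hyz r2.2.2 with h2 | h2 | h2
      · rcases T.trichotomy (x := x) (y := z) r2.1 (by omega) r2.2.2 with h3 | h3 | h3
        · obtain ⟨k, hk⟩ := h2.exists_inSub (by omega)
          obtain ⟨l, hl⟩ := h3.exists_inSub (by omega)
          rw [hk.card_eq, hl.card_eq]
          by_contra hc
          exact hno ⟨z, k, l, by omega, hk, hl⟩
        · rw [h3.card_eq]; omega
        · exact absurd (h3.below h2 rx) hno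
      · exact absurd (h1.trans h2).card_eq h00
      · rw [h2.card_eq' (by omega)]; exact hbd _ _
    · exact absurd (h1.card_eq' hxy) h0

theorem treeAscent_iff (T : SDecTree n s) (a b : ℕ) : T.TreeAscent a b ↔ Asc n s T.card a b := by
  constructor
  · rintro ⟨h1, h2, h3, ⟨i, h4, h5⟩, h6, h7⟩
    obtain ⟨_, _, _, g1, g2⟩ := (T.inSub_iff (by omega) _ _).1 h5
    refine ⟨h1, h2, h3, g1, by omega, ?_, ?_⟩
    · intro e hae heb han
      exact h6 e _ hae heb ((T.inSub_iff (by omega) _ _).2 ⟨h1, hae, by omega, han, rfl⟩)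
    · intro hs x hx hxa han hc
      exact h7 hs x ((T.inSub_iff h1 _ _).2 ⟨hx, hxa, by omega, han, hc⟩)
  · intro h
    have h1 := h.one_le
    have h2 := h.lt
    have h3 := h.le
    refine ⟨h1, h2, h3, ⟨_, h.lts, (T.inSub_iff (by omega) _ _).2 ⟨h1, h2, h3, h.an, rfl⟩⟩, ?_, ?_⟩
    · intro e j hae heb hin
      obtain ⟨_, _, _, g1, g2⟩ := (T.inSub_iff (by omega) _ _).1 hin
      rw [← g2]
      exact h.mid e hae heb g1
    · intro hs x hin
      obtain ⟨g3, g4, _, g1, g2⟩ := (T.inSub_iff h1 _ _).1 hin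
      exact h.leaf hs x g3 g4 g1 g2

theorem isRotation_iff (T Z : SDecTree n s) (a b : ℕ) :
    T.IsRotation Z a b ↔ Asc n s T.card a b ∧ Z.card = rot T.card a b := by
  unfold IsRotation
  rw [treeAscent_iff]
  refine and_congr_right (fun h => ?_)
  simp only [tcInv_eq_rot T.tinv h]
  constructor
  · intro hh
    funext y x
    by_cases hr : 1 ≤ x ∧ x < y ∧ y ≤ n
    · exact hh y x hr.1 hr.2.1 hr.2.2
    · have h1 : Z.card y x = 0 := by
        by_contra hc
        exact hr (Z.card_supp y x hc)
      have h2 : rot T.card a b y x = 0 := by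
        by_contra hc
        exact hr ((T.tinv.rot h).supp y x hc)
      omega
  · intro hh y x _ _ _
    rw [hh]

theorem rotation_cov {T Z : SDecTree n s} {a b : ℕ} (h : T.IsRotation Z a b) : T.wcov Z := by
  obtain ⟨h1, h2⟩ := (isRotation_iff T Z a b).1 h
  refine ⟨⟨?_, ?_⟩, ?_⟩
  · intro y x
    rw [h2]
    exact le_rot _ _ _ _
  · intro hc
    have := hc b a
    rw [h2, rot_of_mov (Or.inl rfl)] at this
    omega
  · rintro U ⟨u1, u2⟩ ⟨u3, u4⟩
    apply u4
    unfold wle at *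
    rw [h2] at u3 ⊢
    exact rot_cover T.tinv U.tinv h1 u1 u3 u2

end SDecTree

/-! ### Reconstruction of a tree from its inversion set -/

theorem anc_top {n : ℕ} {s : ℕ → ℕ} {I : ℕ → ℕ → ℕ} (h : TInv n s I) (x : ℕ) : anc I x n := by
  intro z hz
  have h1 : I z x = 0 := by
    by_contra hc
    have := h.supp _ _ hc
    omega
  have h2 : I z n = 0 := by
    by_contra hc
    have := h.supp _ _ hc
    omega
  omega

theorem exists_parent {n : ℕ} {s : ℕ → ℕ} {I : ℕ → ℕ → ℕ} (h : TInv n s I) :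
    ∃ p : ℕ → ℕ, (∀ v, 1 ≤ v → v < n → v < p v ∧ p v ≤ n ∧ anc I v (p v) ∧
      ∀ w, v < w → anc I v w → p v ≤ w) ∧ ∀ v, v = 0 ∨ n ≤ v → p v = 0 := by
  have key : ∀ v, ∃ q, (1 ≤ v → v < n → v < q ∧ q ≤ n ∧ anc I v q ∧
      ∀ w, v < w → anc I v w → q ≤ w) ∧ (v = 0 ∨ n ≤ v → q = 0) := by
    intro v
    by_cases hv : 1 ≤ v ∧ v < n
    · have hex : ∃ q, v < q ∧ anc I v q := ⟨n, hv.2, anc_top h v⟩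
      have hs := Nat.find_spec hex
      refine ⟨Nat.find hex, fun _ _ => ⟨hs.1, Nat.find_min' hex ⟨hv.2, anc_top h v⟩, hs.2,
        fun w hw hw' => Nat.find_min' hex ⟨hw, hw'⟩⟩, fun hc => by omega⟩
    · exact ⟨0, fun h1 h2 => by omega, fun _ => rfl⟩
  choose p hp using key
  exact ⟨p, fun v => (hp v).1, fun v => (hp v).2⟩

theorem exists_tree {n : ℕ} {s : ℕ → ℕ} {I : ℕ → ℕ → ℕ} (h : TInv n s I) :
    ∃ T : SDecTree n s, T.card = I := by
  obtain ⟨p, hp, hp0⟩ := exists_parent h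
  have hslot : ∀ v w, 1 ≤ v → v < w → w < n → p v = p w → I (p v) v = I (p w) w → False := by
    intro v w hv hvw hw hpp hII
    obtain ⟨v1, v2, v3, v4⟩ := hp v hv (by omega)
    obtain ⟨w1, w2, w3, w4⟩ := hp w (by omega) hw
    have hbig : ∀ z, p v ≤ z → ¬ (w < z ∧ I z v ≠ I z w) := by
      rintro z hz ⟨_, hne⟩
      rcases hz.eq_or_lt with rfl | hz
      · rw [hII, ← hpp] at hne; exact hne rfl
      · rw [v3 z hz, w3 z (by omega), hpp] at hne; exact hne rfl
    have : anc I v w := by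
      intro z hz
      by_contra hne
      obtain ⟨m, m1, m2, m3, m4⟩ :=
        exists_max_row (P := fun z => w < z ∧ I z v ≠ I z w) (w := z) (N := p v) ⟨hz, hne⟩ hbig
      have := h.max_anc (x := v) (y := w) (w := m) (by omega) (by omega) m3.2
        (fun u hu => by by_contra hc; exact m4 u hu ⟨by omega, hc⟩)
      have := v4 m (by omega) this.1
      omega
    have := v4 w hvw this
    omega
  let T : SDecTree n s :=
    { parent := p
      idx := fun v => I (p v) v
      parent_gt := fun v h1 h2 => (hp v h1 h2).1
      parent_le := fun v h1 h2 => (hp v h1 h2).2.1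
      idx_le := fun v _ _ => h.bd _ _
      slot_inj := by
        intro v w hv hv' hw hw' h1 h2
        rcases lt_trichotomy v w with hlt | heq | hlt
        · exact (hslot v w hv hlt hw' h1 h2).elim
        · exact heq
        · exact (hslot w v hw hlt hv' h1.symm h2.symm).elim
      parent_out := hp0
      idx_out := by
        intro v hv
        rw [hp0 v hv]
        by_contra hc
        have := h.supp _ _ hc
        omega }
  have hTp : T.parent = p := rfl
  -- weak descent
  have hdesc : ∀ x y, 1 ≤ x → x < y → y ≤ n → anc I x y → T.InSub y (I y x) x := by
    intro x y
    induction x using T.up_induction with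
    | h x ih =>
      intro hx hxy hyn han
      obtain ⟨v1, v2, v3, v4⟩ := hp x hx (by omega)
      have hle := v4 y hxy han
      rcases hle.eq_or_lt with heq | hlt
      · refine ⟨x, T.descend_refl hx (by omega), heq, ?_⟩
        change I (p x) x = _
        rw [heq]
      · have h1 := ih ⟨hx, by omega⟩ (by rw [hTp]; omega) hlt hyn (fun z hz => by
          rw [hTp, ← v3 z (by omega), han z hz])
        rw [hTp, ← v3 y hlt] at h1
        refine h1.below ((T.descend_iff _ _).2 ⟨by omega, Or.inr (T.descend_refl ?_ ?_)⟩)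
        · rw [hTp]; omega
        · rw [hTp]; omega
  have hanc : ∀ x y, T.Descend x y → x = y ∨ anc I x y := by
    intro x y
    induction x using T.up_induction with
    | h x ih =>
      intro hd
      obtain ⟨hx, rfl | h1⟩ := (T.descend_iff _ _).1 hd
      · exact Or.inl rfl
      · right
        have hr := T.lt_of_parent h1.range.1
        have hl := h1.le
        obtain ⟨v1, v2, v3, v4⟩ := hp x hr.1 hr.2
        rw [hTp] at hl
        rcases ih hr h1 with h2 | h2
        · rw [← h2]; exact v3
        · intro z hz
          rw [v3 z (by omega)]
          exact h2 z hz
  have hin : ∀ x y j, 1 ≤ y → T.InSub y j x → I y x = j := by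
    rintro x y j hy ⟨c, h1, rfl, rfl⟩
    have hr := T.lt_of_parent hy
    have := T.parent_gt c hr.1 hr.2
    change _ = I (p c) c
    rcases hanc x c h1 with rfl | h2
    · rfl
    · exact h2 _ this
  refine ⟨T, ?_⟩
  funext y x
  by_cases hr : 1 ≤ x ∧ x < y ∧ y ≤ n
  · obtain ⟨hx, hxy, hyn⟩ := hr
    rcases T.trichotomy hx hxy hyn with h1 | h1 | h1
    · obtain ⟨j, hj⟩ := h1.exists_inSub hxy.ne
      rw [hj.card_eq, hin x y j (by omega) hj]
    · rw [h1.card_eq]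
      obtain ⟨z, i, j, hij, h2, h3⟩ := h1
      have hz := h2.pos h3 hij
      have e1 := hin _ _ _ hz h2
      have e2 := hin _ _ _ hz h3
      by_contra hc
      have := h.tr x y z hxy (h3.desc hz).2.1 (Ne.symm hc)
      omega
    · rw [h1.card_eq' hxy]
      obtain ⟨z, i, j, hij, h2, h3⟩ := h1
      have hz := h2.pos h3 hij
      have e1 := hin _ _ _ hz h2
      have e2 := hin _ _ _ hz h3
      by_contra hc
      have := h.pl x y z hxy (h2.desc hz).2.1 (Ne.symm hc)
      omega
  · have h1 : T.card y x = 0 := by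
      by_contra hc
      exact hr (T.card_supp y x hc)
    have h2 : I y x = 0 := by
      by_contra hc
      exact hr (h.supp y x hc)
    omega

/-- if `(c,d)` is not a tree ascent of `Z`, there is a saturated chain
`T ⋖ Z ⋖ P ⋖ Z ∨ Q` where `P` is the rotation of `Z` along the tree ascent `(a,d)` of
`Z` and `Z ∨ Q` is the rotation of `P` along the tree ascent `(c,d)` of `P`. -/
theorem chain_in_pentagon (n : ℕ) (s : ℕ → ℕ) (T Z Q W : SDecTree n s)
    (a b c d : ℕ) (hac : a < c)
    (hZ : SDecTree.IsRotation T Z a b) (hQ : SDecTree.IsRotation T Q c d)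
    (hnot : ¬ Z.TreeAscent c d) (hW : SDecTree.IsJoin Z Q W) :
    ∃ P : SDecTree n s,
      SDecTree.wcov T Z ∧ SDecTree.wcov Z P ∧ SDecTree.wcov P W ∧
      SDecTree.IsRotation Z P a d ∧ SDecTree.IsRotation P W c d := by
  obtain ⟨h1, eZ⟩ := (SDecTree.isRotation_iff T Z a b).1 hZ
  obtain ⟨h2, eQ⟩ := (SDecTree.isRotation_iff T Q c d).1 hQ
  rw [SDecTree.treeAscent_iff, eZ] at hnot
  obtain ⟨rfl, hs⟩ := asc_case T.tinv hac h1 h2 hnot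
  have hbd := h2.lt
  have aZ : Asc n s Z.card a d := by rw [eZ]; exact asc_Z h1 h2 hs
  obtain ⟨P, eP⟩ := exists_tree (Z.tinv.rot aZ)
  have rP : SDecTree.IsRotation Z P a d := (SDecTree.isRotation_iff _ _ _ _).2 ⟨aZ, eP⟩
  have aP : Asc n s P.card b d := by rw [eP, eZ]; exact asc_P h1 h2
  obtain ⟨V, eV⟩ := exists_tree (P.tinv.rot aP)
  obtain ⟨w1, w2, w3⟩ := hW
  have hPd : P.card d b = T.card d b := by
    rw [eP, rot_of_lt hac, eZ, rot_of_lt hac]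
  have hTZ : ∀ y x, T.card y x ≤ Z.card y x := by
    intro y x; rw [eZ]; exact le_rot _ _ _ _
  have hZV : ∀ y x, Z.card y x ≤ V.card y x := by
    intro y x
    refine (le_rot a d y x).trans ?_
    rw [← eP, eV]
    exact le_rot _ _ _ _
  have hQV : ∀ y x, Q.card y x ≤ V.card y x := by
    rw [eQ]
    refine rot_le h2 V.tinv.tr (fun y x => (hTZ y x).trans (hZV y x)) ?_
    rw [eV, rot_of_mov (Or.inl rfl), hPd]
    omega
  have hWV := w3 V hZV hQV
  have hWd : T.card d b < W.card d b := by
    have := w2 d b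
    rw [eQ, rot_of_mov (Or.inl rfl)] at this
    omega
  have hPW : ∀ y x, P.card y x ≤ W.card y x := by
    rw [eP]
    refine rot_le aZ W.tinv.tr w1 ?_
    have h3 := w1 b a
    rw [eZ, rot_of_mov (Or.inl rfl)] at h3
    have h4 := W.tinv.tr a b d hac hbd (by omega)
    have h5 : Z.card d a = T.card d b := by
      rw [eZ, rot_of_ne (by omega), h1.an d hbd]
    omega
  have hVW : ∀ y x, V.card y x ≤ W.card y x := by
    rw [eV]
    exact rot_le aP W.tinv.tr hPW (by omega)
  have eW : W.card = rot P.card b d := by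
    rw [← eV]
    funext y x
    exact le_antisymm (hWV y x) (hVW y x)
  have rW : SDecTree.IsRotation P W b d := (SDecTree.isRotation_iff _ _ _ _).2 ⟨aP, eW⟩
  exact ⟨P, SDecTree.rotation_cov hZ, SDecTree.rotation_cov rP, SDecTree.rotation_cov rW, rP, rW⟩
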